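/- arXiv:2508.02859 — 2 statements merged into one kernel-verified Lean document; each statement's English description precedes it below -/
import Mathlib

section
/- Let k be a field of characteristic ≠ 2, let s > 2 be an integer, and let ε be a primitive 2^s-th root of unity in a fixed algebraic closure of k. Let Q be the generalized quaternion group of order 2^{s+1}, i.e. the group ⟨w, v : w^{2^{s−1}} = v², w^{2^s} = 1, v w v⁻¹ = w⁻¹⟩ (Mathlib's QuaternionGroup (2^{s−1})). Then the minimal faithful representation dimension of Q over k equals: 2·[k(ε):k] if there is no k-algebra automorphism of k(ε) sending ε to ε⁻¹; [k(ε):k] if such an automorphism exists and the equation x² + y² = −1 has a solution with x, y ∈ k(ε+ε⁻¹); and 2·[k(ε):k] if such an automorphism exists and x² + y² = −1 has no solution in k(ε+ε⁻¹). -/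
open IntermediateField

/-- The minimal faithful representation dimension of a group `G` over a field `k`:
the least `d` such that there is an injective group homomorphism `G →* GL d k`. -/
noncomputable def minFaithfulDim (k : Type*) [Field k] (G : Type*) [Group G] : ℕ :=
  sInf {d : ℕ | ∃ φ : G →* Matrix.GeneralLinearGroup (Fin d) k, Function.Injective φ}

theorem QuaternionGroup.exists_injective_hom {H : Type*} [Group H] {n : ℕ} (hn : 2 ≤ n) {w v : H}
    (hw : orderOf w = 2 * n) (hv : v * v = w ^ n) (hvw : v * w = w⁻¹ * v) :
    ∃ φ : QuaternionGroup n →* H, Function.Injective φ := by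
  have hker : zmultiplesHom (Additive H) (Additive.ofMul w) ((2 * n : ℕ) : ℤ) = 0 := by
    rw [zmultiplesHom_apply, natCast_zsmul, ← ofMul_pow, ← hw, pow_orderOf_eq_one, ofMul_one]
  let f : ZMod (2 * n) → H := fun i =>
    (ZMod.lift (2 * n) ⟨zmultiplesHom (Additive H) (Additive.ofMul w), hker⟩ i).toMul
  have hf_int (m : ℤ) : f (m : ZMod (2 * n)) = w ^ m := by
    simp [f, ZMod.lift_coe]
  have hf_nat (m : ℕ) : f (m : ZMod (2 * n)) = w ^ m := by
    simpa using hf_int m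
  have hf_add (i j) : f (i + j) = f i * f j := by simp [f]
  have hf_zero : f 0 = 1 := by simp [f]
  have hconj (i) : v * f i = f (-i) * v := by
    obtain ⟨m, rfl⟩ := ZMod.intCast_surjective i
    rw [← Int.cast_neg, hf_int, hf_int]
    have h : SemiconjBy v w w⁻¹ := hvw
    simpa using (h.zpow_right m).eq
  have hf_one : ∀ i, f i = 1 → i = 0 := by
    intro i hi
    obtain ⟨m, rfl⟩ := ZMod.intCast_surjective i
    rw [hf_int] at hi
    rw [ZMod.intCast_zmod_eq_zero_iff_dvd, ← hw]
    exact orderOf_dvd_iff_zpow_eq_one.mpr hi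
  let φ : QuaternionGroup n →* H :=
    { toFun := fun g => match g with
        | .a i => f i
        | .xa i => v * f i
      map_one' := hf_zero
      map_mul' := by
        rintro (i | i) (j | j)
        · simp [hf_add]
        · simp only [QuaternionGroup.a_mul_xa]
          rw [← mul_assoc, ← neg_neg i, ← hconj (-i), mul_assoc, ← hf_add, neg_neg]
          congr 2; ring
        · simp [hf_add, mul_assoc]
        · simp only [QuaternionGroup.xa_mul_xa]
          rw [mul_assoc, ← mul_assoc (f i), ← neg_neg i, ← hconj (-i), mul_assoc, ← hf_add,
            ← mul_assoc, hv, ← hf_nat, ← hf_add, neg_neg]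
          congr 1; ring }
  refine ⟨φ, (injective_iff_map_eq_one φ).mpr ?_⟩
  rintro (i | i) hi
  · have : i = 0 := hf_one i hi
    rw [this, QuaternionGroup.a_zero]
  · exfalso
    have hi' : v * f i = 1 := hi
    have hvi : v = f (-i) := by
      have h1 : f (-i) * f i = 1 := by rw [← hf_add, neg_add_cancel, hf_zero]
      exact mul_right_cancel (hi'.trans h1.symm)
    have hcomm : v * w = w * v := by
      have h1 : w = f 1 := by simpa using (hf_nat 1).symm
      rw [hvi, h1, ← hf_add, ← hf_add, add_comm]
    have hsq : w ^ 2 = 1 := by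
      have h1 : w = w⁻¹ := mul_right_cancel (hcomm.symm.trans hvw)
      rw [pow_two]
      nth_rewrite 2 [h1]
      exact mul_inv_cancel w
    have := Nat.le_of_dvd two_pos (orderOf_dvd_of_pow_eq_one hsq)
    omega

/-- A basis identifies the units of `End V` with invertible matrices. -/
noncomputable def Module.End.unitsEquivGL (k V : Type*) [Field k] [AddCommGroup V] [Module k V]
    [FiniteDimensional k V] :
    (Module.End k V)ˣ ≃* Matrix.GeneralLinearGroup (Fin (Module.finrank k V)) k :=
  Units.mapEquiv (LinearMap.toMatrixAlgEquiv (Module.finBasis k V)).toMulEquiv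

theorem minFaithfulDim_le_finrank {k : Type*} [Field k] {G : Type*} [Group G] {V : Type*}
    [AddCommGroup V] [Module k V] [FiniteDimensional k V] {φ : G →* (Module.End k V)ˣ}
    (hφ : Function.Injective φ) : minFaithfulDim k G ≤ Module.finrank k V :=
  Nat.sInf_le ⟨(Module.End.unitsEquivGL k V).toMonoidHom.comp φ,
    (Module.End.unitsEquivGL k V).injective.comp hφ⟩

theorem le_minFaithfulDim {k : Type*} [Field k] {G : Type*} [Group G] {V : Type*}
    [AddCommGroup V] [Module k V] [FiniteDimensional k V] {φ : G →* (Module.End k V)ˣ}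
    (hφ : Function.Injective φ) {D : ℕ}
    (hD : ∀ (d : ℕ) (ψ : G →* (Module.End k (Fin d → k))ˣ), Function.Injective ψ → D ≤ d) :
    D ≤ minFaithfulDim k G := by
  refine le_csInf ⟨_, (Module.End.unitsEquivGL k V).toMonoidHom.comp φ,
    (Module.End.unitsEquivGL k V).injective.comp hφ⟩ ?_
  rintro d ⟨ψ, hψ⟩
  let e := Units.mapEquiv (Matrix.toLinAlgEquiv' (R := k) (n := Fin d)).toMulEquiv
  exact hD d (e.toMonoidHom.comp ψ) (e.injective.comp hψ)

section LowerBound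

open Polynomial

variable {k K V : Type*} [Field k] [Field K] [Algebra k K] [AddCommGroup V] [Module k V]

/-- If `T` exchanges `W` and its inverse `W'`, then `T` exchanges polynomials in them. -/
theorem Module.End.apply_aeval_of_semiconj {W W' T : Module.End k V} (h : T * W = W' * T)
    (q : k[X]) (x : V) : T (aeval W q x) = aeval W' q (T x) := by
  induction q using Polynomial.induction_on' generalizing x with
  | add p q hp hq => simp [hp, hq]
  | monomial m c =>
    have h1 : SemiconjBy T W W' := h
    have h2 : T * W ^ m = W' ^ m * T := (h1.pow_right m).eq
    have h3 := LinearMap.congr_fun h2 x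
    simp only [Module.End.mul_apply] at h3
    simp [aeval_monomial, h3]

/-- A vector killed by the minimal polynomial of a generator `z` of `K` spans a copy of `K`. -/
theorem exists_injective_linearMap_of_aeval_minpoly {z : K}
    (hz : Function.Surjective (aeval (R := k) z)) {W : Module.End k V} {u : V} (hu : u ≠ 0)
    (hWu : aeval W (minpoly k z) u = 0) :
    ∃ φ : K →ₗ[k] V, Function.Injective φ ∧
      ∀ (q : k[X]) x, aeval W q (φ x) = φ (aeval z q * x) := by
  have key (p q : k[X]) (h : aeval z p = aeval z q) : aeval W p u = aeval W q u := by
    obtain ⟨r, hr⟩ := minpoly.dvd k z (p := p - q) (by simp [h])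
    rw [← sub_eq_zero, ← LinearMap.sub_apply, ← map_sub, hr, mul_comm, map_mul,
      Module.End.mul_apply, hWu, map_zero]
  choose g hg using hz
  have hφ (p : k[X]) : aeval W (g (aeval z p)) u = aeval W p u := key _ _ (hg _)
  let φ : K →ₗ[k] V :=
    { toFun := fun x => aeval W (g x) u
      map_add' := fun x y => by
        rw [← LinearMap.add_apply, ← map_add]
        exact key _ _ (by simp [hg])
      map_smul' := fun c x => by
        rw [RingHom.id_apply, ← LinearMap.smul_apply, ← map_smul]
        exact key _ _ (by simp [hg]) }
  have hmul (q : k[X]) (x : K) : aeval W q (φ x) = φ (aeval z q * x) := by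
    change aeval W q (aeval W (g x) u) = aeval W (g (aeval z q * x)) u
    rw [← Module.End.mul_apply, ← map_mul]
    exact key _ _ (by simp [hg])
  refine ⟨φ, (injective_iff_map_eq_zero φ).mpr fun x hx => ?_, hmul⟩
  by_contra hx0
  have h1 := hmul (g x⁻¹) x
  rw [hx, map_zero, hg, inv_mul_cancel₀ hx0] at h1
  have h2 : φ 1 = u := (key (g 1) 1 (by simp [hg])).trans (by simp)
  exact hu (h2.symm.trans h1.symm)

/-- Either the two copies `φ(K)` and `T φ(K)` of `K` are independent, or `T` induces a
semilinear operator on `K`. -/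
theorem two_mul_finrank_le_or_exists_algHom [FiniteDimensional k V] {z : K}
    (hz : Function.Surjective (aeval (R := k) z)) {W W' T : Module.End k V}
    (hWW' : W' * W = 1) (hTW : T * W = W' * T) {φ : K →ₗ[k] V} (hφ : Function.Injective φ)
    (hφW : ∀ (q : k[X]) x, aeval W q (φ x) = φ (aeval z q * x)) (hTT : ∀ x, T (T (φ x)) = - φ x) :
    2 * Module.finrank k K ≤ Module.finrank k V ∨
      ∃ σ : K →ₐ[k] K, σ z = z⁻¹ ∧ ∃ a, a * σ a = -1 := by
  have hTφ : Function.Injective (T ∘ₗ φ) := by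
    refine (injective_iff_map_eq_zero _).mpr fun x hx => hφ ?_
    have h1 := hTT x
    rw [LinearMap.comp_apply] at hx
    rw [hx, map_zero, zero_eq_neg] at h1
    rw [h1, map_zero]
  by_cases hdisj : Disjoint (LinearMap.range φ) (LinearMap.range (T ∘ₗ φ))
  · left
    have := Submodule.finrank_add_finrank_le_of_disjoint hdisj
    rwa [LinearMap.finrank_range_of_inj hφ, LinearMap.finrank_range_of_inj hTφ, ← two_mul] at this
  right
  obtain ⟨x, y, hy, hxy⟩ : ∃ x y, y ≠ 0 ∧ T (φ y) = φ x := by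
    rw [Submodule.disjoint_def] at hdisj
    push Not at hdisj
    obtain ⟨_, ⟨x, rfl⟩, ⟨y, hy⟩, h0⟩ := hdisj
    refine ⟨x, y, ?_, hy⟩
    rintro rfl
    exact h0 (by rw [← hy, map_zero])
  have hz0 : z ≠ 0 := by
    rintro rfl
    have h1 : W (φ 1) = 0 := by simpa using hφW X 1
    have h2 : W' (W (φ 1)) = φ 1 := LinearMap.congr_fun hWW' _
    rw [h1, map_zero] at h2
    exact one_ne_zero (hφ (h2.symm.trans (map_zero φ).symm))
  have hW'1 (x : K) : W' (φ x) = φ (z⁻¹ * x) := by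
    have h1 : W (φ (z⁻¹ * x)) = φ x := by
      simpa [hz0] using hφW X (z⁻¹ * x)
    have h2 : W' (W (φ (z⁻¹ * x))) = φ (z⁻¹ * x) := LinearMap.congr_fun hWW' _
    rw [← h2, h1]
  have hW' (q : k[X]) (x : K) : aeval W' q (φ x) = φ (aeval z⁻¹ q * x) := by
    have h1 : φ ∘ₗ LinearMap.mulLeft k z⁻¹ = W' ∘ₗ φ := by
      ext x; simp [hW'1]
    have h2 (m : ℕ) (x : K) : (W' ^ m) (φ x) = φ (z⁻¹ ^ m * x) := by
      induction m generalizing x with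
      | zero => simp
      | succ m ih => rw [pow_succ, Module.End.mul_apply, hW'1, ih, pow_succ, mul_assoc]
    induction q using Polynomial.induction_on' with
    | add p q hp hq => simp [hp, hq, add_mul]
    | monomial m c =>
      simp [aeval_monomial, h2, ← Algebra.smul_def]
  have hS (c : K) : ∃ b, φ b = T (φ c) := by
    obtain ⟨q, hq⟩ := hz (c * y⁻¹)
    refine ⟨aeval z⁻¹ q * x, ?_⟩
    rw [← hW', ← hxy, ← Module.End.apply_aeval_of_semiconj hTW, hφW, hq, inv_mul_cancel_right₀ hy]
  choose S hS using hS
  have hSmul (q : k[X]) (c : K) : S (aeval z q * c) = aeval z⁻¹ q * S c := hφ <| by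
    rw [hS, ← hφW, Module.End.apply_aeval_of_semiconj hTW, ← hS, hW']
  have hSS (c : K) : S (S c) = -c := hφ <| by rw [hS, hS, hTT, map_neg]
  have hS0 : S 0 = 0 := hφ <| by rw [hS, map_zero, map_zero]
  have ha : S 1 ≠ 0 := by
    intro h
    have := hSS 1
    rw [h, hS0, zero_eq_neg] at this
    exact one_ne_zero this
  let σl : K →ₗ[k] K :=
    { toFun := fun x => S x * (S 1)⁻¹
      map_add' := fun x y => by
        rw [← add_mul]
        congr 1
        exact hφ <| by simp [hS]
      map_smul' := fun c x => by
        rw [RingHom.id_apply, ← smul_mul_assoc]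
        congr 1
        exact hφ <| by simp [hS] }
  let σ : K →ₐ[k] K := AlgHom.ofLinearMap σl (mul_inv_cancel₀ ha) fun x y => by
    change S (x * y) * (S 1)⁻¹ = S x * (S 1)⁻¹ * (S y * (S 1)⁻¹)
    obtain ⟨q, rfl⟩ := hz x
    have h1 := hSmul q 1
    rw [mul_one] at h1
    rw [hSmul, h1, mul_inv_cancel_right₀ ha, mul_assoc]
  refine ⟨σ, ?_, S 1, ?_⟩
  · change S z * (S 1)⁻¹ = z⁻¹
    have := hSmul X 1
    rw [aeval_X, aeval_X, mul_one] at this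
    rw [this, mul_inv_cancel_right₀ ha]
  · change S 1 * (S (S 1) * (S 1)⁻¹) = -1
    rw [hSS]
    field_simp

theorem exists_irreducible_factor_ker_ne_bot {W : Module.End k V} {p : k[X]} (hp : p ≠ 0) {u : V}
    (hu : u ≠ 0) (hpu : aeval W p u = 0) :
    ∃ g, Irreducible g ∧ g ∣ p ∧ ∃ u, u ≠ 0 ∧ aeval W g u = 0 := by
  induction p using WfDvdMonoid.induction_on_irreducible generalizing u with
  | zero => exact absurd rfl hp
  | unit p hunit =>
    obtain ⟨q, hq⟩ := hunit.exists_left_inv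
    refine absurd ?_ hu
    have h1 : aeval W q (aeval W p u) = u := by
      rw [← Module.End.mul_apply, ← map_mul, hq, map_one, Module.End.one_apply]
    rw [← h1, hpu, map_zero]
  | mul p g hp0 hg ih =>
    by_cases h : aeval W p u = 0
    · obtain ⟨g', hg', hdvd, hu'⟩ := ih hp0 hu h
      exact ⟨g', hg', hdvd.mul_left g, hu'⟩
    · refine ⟨g, hg, dvd_mul_right g p, _, h, ?_⟩
      rwa [map_mul, Module.End.mul_apply] at hpu

end LowerBound

section Representations

open Polynomial

theorem IsPrimitiveRoot.pow_eq_neg_one_of_two_mul {R : Type*} [CommRing R] [IsDomain R] {e : R}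
    {n : ℕ} (hn : n ≠ 0) (he : IsPrimitiveRoot e (2 * n)) : e ^ n = -1 := by
  have h1 : (e ^ n) ^ 2 = 1 := by rw [← pow_mul, mul_comm, he.pow_eq_one]
  refine (sq_eq_one_iff.mp h1).resolve_left fun h => ?_
  have := Nat.le_of_dvd (Nat.pos_of_ne_zero hn) (he.dvd_of_pow_eq_one n h)
  omega

/-- A faithful representation of the quaternion group on an algebra `R`, by a unit `u` and an
involution `σ` inverting it, twisted by an element of norm `-1`. -/
theorem QuaternionGroup.exists_injective_hom_units_end {k R : Type*} [Field k] [CommRing R]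
    [Algebra k R] {n : ℕ} (hn : 2 ≤ n) {u : Rˣ} (hu : orderOf u = 2 * n)
    (hun : (u : R) ^ n = -1) {σ : R →ₐ[k] R} (hσ : ∀ x, σ (σ x) = x)
    (hσu : σ u = (u⁻¹ : Rˣ)) {a : R} (ha : a * σ a = -1) :
    ∃ φ : QuaternionGroup n →* (Module.End k R)ˣ, Function.Injective φ := by
  let L : Rˣ →* (Module.End k R)ˣ := Units.map (Algebra.lmul k R : R →* Module.End k R)
  have hL : Function.Injective L := Units.map_injective Algebra.lmul_injective
  have hLu (x : Rˣ) (y : R) : (L x : Module.End k R) y = x * y := rfl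
  let T : Module.End k R := LinearMap.mulLeft k a ∘ₗ σ.toLinearMap
  have hT (x : R) : T x = a * σ x := rfl
  have hTT : T * T = -1 := by
    ext x
    simp only [Module.End.mul_apply, hT, map_mul, hσ, LinearMap.neg_apply, Module.End.one_apply]
    linear_combination x * ha
  let v : (Module.End k R)ˣ := 
    ⟨T, -T, (mul_neg T T).trans (by rw [hTT, neg_neg]), (neg_mul T T).trans (by rw [hTT, neg_neg])⟩
  refine QuaternionGroup.exists_injective_hom hn (w := L u) (v := v)
    ((orderOf_injective L hL u).trans hu) (Units.ext ?_) (Units.ext ?_)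
  · change T * T = _
    rw [hTT, ← map_pow]
    ext x
    simp only [LinearMap.neg_apply, Module.End.one_apply, hLu, Units.val_pow_eq_pow_val, hun,
      neg_one_mul]
  · ext x
    change T ((L u).1 x) = (L u)⁻¹.1 (T x)
    rw [← map_inv, hT, hT, hLu, hLu, map_mul, hσu]
    ring

variable {k K : Type*} [Field k] [Field K] [Algebra k K] {n : ℕ} {e : K}

theorem IsPrimitiveRoot.exists_unit {m : ℕ} (hm : m ≠ 0) (he : IsPrimitiveRoot e m) :
    ∃ u : Kˣ, (u : K) = e ∧ orderOf u = m :=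
  ⟨Units.mk0 e (he.ne_zero hm), rfl, by rw [← orderOf_units, Units.val_mk0, ← he.eq_orderOf]⟩

variable (k) in
theorem exists_injective_hom_units_end_prod (hn : 2 ≤ n) (he : IsPrimitiveRoot e (2 * n)) :
    ∃ φ : QuaternionGroup n →* (Module.End k (K × K))ˣ, Function.Injective φ := by
  obtain ⟨u, rfl, hu⟩ := he.exists_unit (by omega)
  have hun := he.pow_eq_neg_one_of_two_mul (by omega)
  have hval (x y : Kˣ) : ((MulEquiv.prodUnits.symm (x, y) : (K × K)ˣ) : K × K) =
      ((x : K), (y : K)) := rfl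
  refine QuaternionGroup.exists_injective_hom_units_end hn
    (u := MulEquiv.prodUnits.symm (u, u⁻¹))
    (σ := (AlgHom.snd k K K).prod (AlgHom.fst k K K)) (a := (-1, 1)) ?_ ?_ ?_ ?_ ?_
  · rw [MulEquiv.orderOf_eq, Prod.orderOf_mk, orderOf_inv, hu, Nat.lcm_self]
  · have : ((u⁻¹ : Kˣ) : K) ^ n = -1 := by
      rw [Units.val_inv_eq_inv_val, inv_pow, hun, inv_neg_one]
    rw [hval, Prod.pow_mk, hun, this]
    rfl
  · rintro ⟨x, y⟩; rfl
  · rw [← map_inv, Prod.inv_mk, hval, hval, inv_inv]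
    rfl
  · ext <;> simp

theorem exists_injective_hom_units_end_of_algHom (hn : 2 ≤ n) (he : IsPrimitiveRoot e (2 * n))
    (hsurj : Function.Surjective (aeval (R := k) e)) {σ : K →ₐ[k] K} (hσ : σ e = e⁻¹) {a : K}
    (ha : a * σ a = -1) :
    ∃ φ : QuaternionGroup n →* (Module.End k K)ˣ, Function.Injective φ := by
  obtain ⟨u, rfl, hu⟩ := he.exists_unit (by omega)
  have hun := he.pow_eq_neg_one_of_two_mul (by omega)
  refine QuaternionGroup.exists_injective_hom_units_end hn hu hun (σ := σ) (fun x => ?_)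
    (by rw [hσ, Units.val_inv_eq_inv_val]) ha
  obtain ⟨q, rfl⟩ := hsurj x
  rw [← aeval_algHom_apply, ← aeval_algHom_apply, hσ, map_inv₀, hσ, inv_inv]

/-- The lower bounds on the dimension of a faithful representation. -/
theorem finrank_le_and_two_mul_finrank_le_or {V : Type*} [AddCommGroup V] [Module k V]
    [FiniteDimensional k V] {s : ℕ} (hns : n = 2 ^ s)
    (he : IsPrimitiveRoot e (2 * n))
    (hsurj : Function.Surjective (aeval (R := k) e))
    {ψ : QuaternionGroup n →* (Module.End k V)ˣ} (hψ : Function.Injective ψ) :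
    Module.finrank k K ≤ Module.finrank k V ∧
      (2 * Module.finrank k K ≤ Module.finrank k V ∨
        ∃ σ : K →ₐ[k] K, σ e = e⁻¹ ∧ ∃ a, a * σ a = -1) := by
  have hn : n ≠ 0 := by rw [hns]; positivity
  have h2n : 2 ^ (s + 1) = 2 * n := by rw [hns, pow_succ, mul_comm]
  have hen := he.pow_eq_neg_one_of_two_mul hn
  have h_neg : (-1 : K) ≠ 1 := by
    intro h
    have := Nat.le_of_dvd (by omega) (he.dvd_of_pow_eq_one n (hen.trans h))
    omega
  let W : Module.End k V := ψ (.a 1)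
  let W' : Module.End k V := ψ (.a (-1))
  let T : Module.End k V := ψ (.xa 0)
  have hWW' : W' * W = 1 := by
    simp only [W, W']
    rw [← Units.val_mul, ← map_mul]
    simp
  have hTW : T * W = W' * T := by
    simp only [W, W', T]
    rw [← Units.val_mul, ← map_mul, ← Units.val_mul, ← map_mul]
    simp
  have hWpow (m : ℕ) : W ^ m = ψ (.a m) := by
    simp only [W]
    rw [← Units.val_pow_eq_pow_val, ← map_pow, QuaternionGroup.a_one_pow]
  have hTT : T * T = W ^ n := by
    rw [hWpow]
    simp only [T]
    rw [← Units.val_mul, ← map_mul]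
    simp
  have hWn : W ^ n ≠ 1 := by
    rw [hWpow, ← Units.val_one, Ne, Units.val_inj, ← map_one ψ, hψ.eq_iff,
      QuaternionGroup.one_def, QuaternionGroup.a.injEq, ZMod.natCast_eq_zero_iff]
    intro h
    have := Nat.le_of_dvd (by omega) h
    omega
  have hW2n : W ^ n * W ^ n = 1 := by
    rw [← pow_add, ← two_mul, hWpow, ZMod.natCast_self, QuaternionGroup.a_zero, map_one,
      Units.val_one]
  obtain ⟨x, hx⟩ : ∃ x, (W ^ n) x - x ≠ 0 := by
    by_contra! h
    exact hWn (LinearMap.ext fun x => sub_eq_zero.mp (h x))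
  have hp0 : (X ^ n + C 1 : k[X]) ≠ 0 := X_pow_add_C_ne_zero (Nat.pos_of_ne_zero hn) 1
  obtain ⟨g, hg, hgdvd, u, hu, hgu⟩ := exists_irreducible_factor_ker_ne_bot (W := W) hp0 hx <| by
    have := LinearMap.congr_fun hW2n x
    simp only [Module.End.mul_apply, Module.End.one_apply] at this
    simp [this]
  have hsplits : (g.map (algebraMap k K)).Splits := by
    refine (X_pow_sub_one_splits he).of_dvd (X_pow_sub_C_ne_zero (by omega) 1) ?_
    refine (Polynomial.map_dvd _ hgdvd).trans ⟨X ^ n - C 1, ?_⟩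
    simp only [Polynomial.map_add, Polynomial.map_pow, map_X, map_one, Polynomial.map_one]
    ring
  obtain ⟨z, hz⟩ := hsplits.exists_eval_eq_zero <| by
    rw [degree_map]
    exact (degree_pos_of_irreducible hg).ne'
  rw [eval_map_algebraMap] at hz
  have hzn : z ^ n = -1 := by
    have := aeval_eq_zero_of_dvd_aeval_eq_zero hgdvd hz
    simp only [map_add, map_pow, aeval_X, map_one] at this
    exact eq_neg_of_add_eq_zero_left this
  have hzprim : IsPrimitiveRoot z (2 * n) := by
    rw [IsPrimitiveRoot.iff_orderOf, ← h2n]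
    have : Fact (Nat.Prime 2) := ⟨Nat.prime_two⟩
    refine orderOf_eq_prime_pow (by rwa [← hns, hzn]) ?_
    rw [h2n, mul_comm, pow_mul, hzn, neg_one_sq]
  have : NeZero (2 * n) := ⟨by omega⟩
  obtain ⟨j, -, rfl⟩ := hzprim.eq_pow_of_pow_eq_one he.pow_eq_one
  have hzsurj : Function.Surjective (aeval (R := k) z) := fun y => by
    obtain ⟨q, rfl⟩ := hsurj y
    exact ⟨q.comp (X ^ j), by simp [aeval_comp]⟩
  have hminpoly : aeval W (minpoly k z) u = 0 := by
    rw [← minpoly.eq_of_irreducible hg hz, mul_comm, map_mul, Module.End.mul_apply, hgu, map_zero]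
  obtain ⟨φ, hφ, hφW⟩ := exists_injective_linearMap_of_aeval_minpoly hzsurj hu hminpoly
  refine ⟨LinearMap.finrank_le_finrank_of_injective hφ,
    (two_mul_finrank_le_or_exists_algHom hzsurj hWW' hTW hφ hφW fun y => ?_).imp_right ?_⟩
  · rw [← Module.End.mul_apply, hTT]
    simpa [hzn] using hφW (X ^ n) y
  · rintro ⟨σ, hσ, ha⟩
    exact ⟨σ, by rw [map_pow, hσ, inv_pow], ha⟩

end Representations

section FixedField

open Polynomial

variable {k K : Type*} [Field k] [Field K] [Algebra k K] {e : K} {σ : K →ₐ[k] K}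

theorem apply_eq_self_of_mem_adjoin_add_inv (hσ : σ e = e⁻¹) {x : K} (hx : x ∈ k⟮e + e⁻¹⟯) :
    σ x = x := by
  have ht : σ (e + e⁻¹) = e + e⁻¹ := by rw [map_add, map_inv₀, hσ, inv_inv, add_comm]
  obtain ⟨p, q, rfl⟩ := (mem_adjoin_simple_iff k x).mp hx
  rw [map_div₀, ← aeval_algHom_apply, ← aeval_algHom_apply, ht]

theorem aeval_mem_add_mul_adjoin_add_inv (he : e ≠ 0) (q : k[X]) :
    ∃ c ∈ k⟮e + e⁻¹⟯, ∃ d ∈ k⟮e + e⁻¹⟯, aeval e q = c + d * e := by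
  have ht := mem_adjoin_simple_self k (e + e⁻¹)
  induction q using Polynomial.induction_on with
  | C r => exact ⟨_, IntermediateField.algebraMap_mem _ r, 0, zero_mem _, by simp⟩
  | add p q hp hq =>
    obtain ⟨c, hc, d, hd, h⟩ := hp
    obtain ⟨c', hc', d', hd', h'⟩ := hq
    exact ⟨_, add_mem hc hc', _, add_mem hd hd', by rw [map_add, h, h']; ring⟩
  | monomial m r h =>
    obtain ⟨c, hc, d, hd, h⟩ := h
    refine ⟨_, neg_mem hd, _, add_mem hc (mul_mem hd ht), ?_⟩
    rw [pow_succ, ← mul_assoc, map_mul, h, aeval_X]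
    field_simp
    ring

theorem mem_adjoin_add_inv_of_apply_eq_self (hsurj : Function.Surjective (aeval (R := k) e))
    (he : e ≠ 0) (he' : e ^ 2 ≠ 1) (hσ : σ e = e⁻¹) {x : K} (hx : σ x = x) :
    x ∈ k⟮e + e⁻¹⟯ := by
  obtain ⟨q, rfl⟩ := hsurj x
  obtain ⟨c, hc, d, hd, h⟩ := aeval_mem_add_mul_adjoin_add_inv he q
  rw [h] at hx ⊢
  rw [map_add, map_mul, hσ, apply_eq_self_of_mem_adjoin_add_inv hσ hc,
    apply_eq_self_of_mem_adjoin_add_inv hσ hd] at hx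
  have h1 : d * (e ^ 2 - 1) = 0 := by
    field_simp at hx
    linear_combination -hx
  rw [(mul_eq_zero.mp h1).resolve_right (sub_ne_zero.mpr he'), zero_mul, add_zero]
  exact hc

/-- The norm form from `K` to the subfield fixed by `σ` is a sum of two squares. -/
theorem exists_mul_apply_eq_neg_one_iff (hsurj : Function.Surjective (aeval (R := k) e))
    (h2 : (2 : K) ≠ 0) (he : e ≠ 0) (he' : e ^ 2 ≠ 1) (hσ : σ e = e⁻¹) {i : K}
    (hi : i ^ 2 = -1) (hσi : σ i = -i) :
    (∃ a, a * σ a = -1) ↔ ∃ x ∈ k⟮e + e⁻¹⟯, ∃ y ∈ k⟮e + e⁻¹⟯, x ^ 2 + y ^ 2 = -1 := by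
  constructor
  · rintro ⟨a, ha⟩
    have hσσ : σ (σ a) = a := by
      obtain ⟨q, rfl⟩ := hsurj a
      rw [← aeval_algHom_apply, ← aeval_algHom_apply, hσ, map_inv₀, hσ, inv_inv]
    refine ⟨(a + σ a) / 2, mem_adjoin_add_inv_of_apply_eq_self hsurj he he' hσ ?_,
      i * (a - σ a) / 2, mem_adjoin_add_inv_of_apply_eq_self hsurj he he' hσ ?_, ?_⟩
    · rw [map_div₀, map_add, hσσ, map_ofNat, add_comm]
    · rw [map_div₀, map_mul, map_sub, hσσ, map_ofNat, hσi]
      ring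
    · field_simp
      linear_combination (a - σ a) ^ 2 * hi + 4 * ha
  · rintro ⟨x, hx, y, hy, hxy⟩
    refine ⟨x + i * y, ?_⟩
    rw [map_add, map_mul, hσi, apply_eq_self_of_mem_adjoin_add_inv hσ hx,
      apply_eq_self_of_mem_adjoin_add_inv hσ hy]
    linear_combination hxy - y ^ 2 * hi

end FixedField

section Adjoin

open Polynomial

variable {k L : Type*} [Field k] [Field L] [Algebra k L]

theorem aeval_adjoinSimple_gen_surjective {ε : L} (hε : IsAlgebraic k ε) :
    Function.Surjective (aeval (R := k) (AdjoinSimple.gen k ε)) := by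
  rintro ⟨x, hx⟩
  rw [← mem_toSubalgebra, adjoin_simple_toSubalgebra_of_isAlgebraic hε,
    Algebra.adjoin_singleton_eq_range_aeval] at hx
  obtain ⟨p, rfl⟩ := hx
  refine ⟨p, Subtype.ext ?_⟩
  exact (aeval_algHom_apply k⟮ε⟯.val (AdjoinSimple.gen k ε) p).symm

theorem exists_sq_add_sq_adjoin_iff (ε : L) :
    (∃ x y : k⟮ε + ε⁻¹⟯, x ^ 2 + y ^ 2 = -1) ↔
      ∃ x ∈ k⟮AdjoinSimple.gen k ε + (AdjoinSimple.gen k ε)⁻¹⟯,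
        ∃ y ∈ k⟮AdjoinSimple.gen k ε + (AdjoinSimple.gen k ε)⁻¹⟯, x ^ 2 + y ^ 2 = -1 := by
  have hmap : k⟮AdjoinSimple.gen k ε + (AdjoinSimple.gen k ε)⁻¹⟯.map k⟮ε⟯.val = k⟮ε + ε⁻¹⟯ := by
    rw [adjoin_map, Set.image_singleton]
    rfl
  constructor
  · rintro ⟨⟨x, hx⟩, ⟨y, hy⟩, h⟩
    rw [← hmap] at hx hy
    obtain ⟨x, hx', rfl⟩ := hx
    obtain ⟨y, hy', rfl⟩ := hy
    refine ⟨x, hx', y, hy', k⟮ε⟯.val.injective ?_⟩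
    have h' := congrArg k⟮ε + ε⁻¹⟯.val h
    simp only [map_add, map_pow, map_neg, map_one] at h' ⊢
    exact h'
  · rintro ⟨x, hx, y, hy, h⟩
    refine ⟨⟨x, hmap ▸ ⟨x, hx, rfl⟩⟩, ⟨y, hmap ▸ ⟨y, hy, rfl⟩⟩, k⟮ε + ε⁻¹⟯.val.injective ?_⟩
    have h' := congrArg k⟮ε⟯.val h
    simp only [map_add, map_pow, map_neg, map_one] at h' ⊢
    exact h'

end Adjoin

theorem stmt16 (k : Type*) [Field k] (hchar : ringChar k ≠ 2)
    (s : ℕ) (hs : 2 < s)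
    (ε : AlgebraicClosure k) (hε : IsPrimitiveRoot ε (2 ^ s)) :
    (¬ (∃ σ : k⟮ε⟯ ≃ₐ[k] k⟮ε⟯, σ (AdjoinSimple.gen k ε) = (AdjoinSimple.gen k ε)⁻¹) →
      minFaithfulDim k (QuaternionGroup (2 ^ (s - 1))) =
        2 * Module.finrank k (IntermediateField.adjoin k {ε})) ∧
    ((∃ σ : k⟮ε⟯ ≃ₐ[k] k⟮ε⟯, σ (AdjoinSimple.gen k ε) = (AdjoinSimple.gen k ε)⁻¹) →
      ((∃ x y : (IntermediateField.adjoin k {ε + ε⁻¹} :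
            IntermediateField k (AlgebraicClosure k)), x ^ 2 + y ^ 2 = -1) →
        minFaithfulDim k (QuaternionGroup (2 ^ (s - 1))) =
          Module.finrank k (IntermediateField.adjoin k {ε})) ∧
      (¬ (∃ x y : (IntermediateField.adjoin k {ε + ε⁻¹} :
            IntermediateField k (AlgebraicClosure k)), x ^ 2 + y ^ 2 = -1) →
        minFaithfulDim k (QuaternionGroup (2 ^ (s - 1))) =
          2 * Module.finrank k (IntermediateField.adjoin k {ε}))) := by
  obtain ⟨r, rfl⟩ := Nat.exists_eq_add_of_lt hs
  rw [show 2 + r + 1 - 1 = r + 2 by omega]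
  set n := 2 ^ (r + 2) with hn_def
  have hn2 : 2 ≤ n := by
    rw [hn_def, pow_succ]
    exact Nat.le_mul_of_pos_left 2 (by positivity)
  rw [show 2 ^ (2 + r + 1) = 2 * n by rw [hn_def, ← pow_succ']; congr 1; omega] at hε
  have hint : IsIntegral k ε := Algebra.IsIntegral.isIntegral ε
  have : FiniteDimensional k k⟮ε⟯ := adjoin.finiteDimensional hint
  have hsurj := aeval_adjoinSimple_gen_surjective hint.isAlgebraic
  rw [exists_sq_add_sq_adjoin_iff]
  have he : IsPrimitiveRoot (AdjoinSimple.gen k ε) (2 * n) :=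
    .of_map_of_injective (f := k⟮ε⟯.val) hε k⟮ε⟯.val.injective
  set e := AdjoinSimple.gen k ε
  have h2 : (2 : k⟮ε⟯) ≠ 0 := by
    rw [← map_ofNat (algebraMap k k⟮ε⟯) 2]
    exact (map_ne_zero _).mpr (Ring.two_ne_zero hchar)
  have he0 : e ≠ 0 := he.ne_zero (by omega)
  have he2 : e ^ 2 ≠ 1 := he.pow_ne_one_of_pos_of_lt two_ne_zero (by omega)
  have hi : (e ^ 2 ^ (r + 1)) ^ 2 = -1 := by
    rw [← pow_mul, ← pow_succ]
    exact he.pow_eq_neg_one_of_two_mul (n := n) (by omega)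
  have hnorm {σ : k⟮ε⟯ →ₐ[k] k⟮ε⟯} (hσ : σ e = e⁻¹) :=
    exists_mul_apply_eq_neg_one_iff hsurj h2 he0 he2 hσ hi <| by
      rw [map_pow, hσ, inv_pow, inv_eq_iff_eq_inv,
        ← mul_eq_one_iff_eq_inv₀ (neg_ne_zero.mpr (pow_ne_zero _ he0))]
      linear_combination -hi
  obtain ⟨φ, hφ⟩ := exists_injective_hom_units_end_prod k hn2 he
  have hle : minFaithfulDim k (QuaternionGroup n) ≤ 2 * Module.finrank k k⟮ε⟯ := by
    have := minFaithfulDim_le_finrank hφ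
    rwa [Module.finrank_prod, ← two_mul] at this
  have hge_two (h : ¬ ∃ σ : k⟮ε⟯ →ₐ[k] k⟮ε⟯, σ e = e⁻¹ ∧ ∃ a, a * σ a = -1) :
      2 * Module.finrank k k⟮ε⟯ ≤ minFaithfulDim k (QuaternionGroup n) :=
    le_minFaithfulDim hφ fun d ψ hψ => by
      simpa using (finrank_le_and_two_mul_finrank_le_or hn_def he hsurj hψ).2.resolve_right h
  refine ⟨fun h => hle.antisymm (hge_two ?_), fun ⟨σ, hσ⟩ => ⟨fun hxy => le_antisymm ?_ ?_,
    fun hxy => hle.antisymm (hge_two ?_)⟩⟩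
  · rintro ⟨σ, hσ, -⟩
    exact h ⟨AlgEquiv.ofBijective σ (Algebra.IsAlgebraic.algHom_bijective σ), hσ⟩
  · obtain ⟨a, ha⟩ := (hnorm (σ := σ) hσ).mpr hxy
    obtain ⟨φ', hφ'⟩ := exists_injective_hom_units_end_of_algHom hn2 he hsurj (σ := σ) hσ ha
    exact minFaithfulDim_le_finrank hφ'
  · exact le_minFaithfulDim hφ fun d ψ hψ => by
      simpa using (finrank_le_and_two_mul_finrank_le_or hn_def he hsurj hψ).1
  · rintro ⟨τ, hτ, ha⟩
    exact hxy ((hnorm hτ).mp ha)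
end

section
/- Let s > 1 and t ≥ 1 be integers and n = 2^t. Let P be a Sylow 2-subgroup of the symmetric group on {1,…,n} with the property that every element of P maps the block I₁ = {1,…,2^{t−1}} either onto itself or onto the block I₂ = {2^{t−1}+1,…,n}, and let P act on (ℤ/2^sℤ)ⁿ by permuting coordinates. Let a = (a₁,…,aₙ) ∈ (ℤ/2^sℤ)ⁿ, set A₁ = Σ_{i∈I₁} aᵢ and A₂ = Σ_{i∈I₂} aᵢ, and suppose A₁ = −A₂ and A₁ is a unit of ℤ/2^sℤ. Then the orbit of a under the action of P has cardinality at least 2^{2t−1}. -/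
open Equiv in
/-- A subgroup of permutations preserving a colouring has order dividing the product of the
factorials of the sizes of the colour classes. -/
theorem card_dvd_prod_factorial_of_comp_eq {α ι : Type*} [Fintype α] [DecidableEq α] [Fintype ι]
    [DecidableEq ι] (H : Subgroup (Perm α)) (c : α → ι) (hc : ∀ h ∈ H, c ∘ h = c) :
    Nat.card H ∣ ∏ i, (Fintype.card {x // c x = i}).factorial := by
  let S : Subgroup (Perm α) :=
    { carrier := {g | c ∘ g = c}
      one_mem' := rfl
      mul_mem' := fun {g h} hg hh => by
        simp only [Set.mem_ofPred_eq, Perm.coe_mul] at *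
        rw [← Function.comp_assoc, hg, hh]
      inv_mem' := fun {g} hg => by
        simp only [Set.mem_ofPred_eq] at *
        nth_rw 1 [← hg]
        ext x
        simp }
  have hS : Nat.card S = ∏ i, (Fintype.card {x // c x = i}).factorial := by
    rw [← DomMulAct.stabilizer_card c, ← Nat.card_eq_fintype_card]
    rfl
  exact hS ▸ Subgroup.card_dvd_of_le (show H ≤ S from hc)

open Equiv in
theorem IsPGroup.exists_fixed_mem_of_not_dvd_card {α : Type*} {p : ℕ} [Fact p.Prime]
    {H : Subgroup (Perm α)} (hH : IsPGroup p H) (S : Finset α)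
    (hS : ∀ h ∈ H, ∀ x ∈ S, h x ∈ S) (hp : ¬ p ∣ S.card) :
    ∃ x ∈ S, ∀ h ∈ H, h x = x := by
  let T : SubMulAction H α :=
    { carrier := S
      smul_mem' := fun h x hx => hS h h.2 x hx }
  have hT : Nat.card T = S.card := Nat.card_eq_card_toFinset (S : Set α) |>.trans (by simp)
  obtain ⟨x, hx⟩ := hH.nonempty_fixed_point_of_prime_not_dvd_card T (hT ▸ hp)
  exact ⟨x, x.2, fun h hh => congrArg Subtype.val (hx ⟨h, hh⟩)⟩

open Equiv in
/-- A 2-group of permutations preserving a function to `ZMod (2 ^ s)` whose sum over an invariant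
set is a unit fixes a point of that set. -/
theorem exists_fixed_mem_of_isUnit_sum {α : Type*} {s : ℕ} (hs : s ≠ 0)
    {H : Subgroup (Perm α)} (hH : IsPGroup 2 H) (S : Finset α)
    (hS : ∀ h ∈ H, ∀ x ∈ S, h x ∈ S) (f : α → ZMod (2 ^ s))
    (hf : ∀ h ∈ H, ∀ x, f (h x) = f x) (hu : IsUnit (∑ x ∈ S, f x)) :
    ∃ x ∈ S, ∀ h ∈ H, h x = x := by
  let φ : ZMod (2 ^ s) →+* ZMod 2 := ZMod.castHom (dvd_pow_self 2 hs) (ZMod 2)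
  have hφ : ((S.filter fun x => φ (f x) = 1).card : ZMod 2) ≠ 0 := by
    have key : φ (∑ x ∈ S, f x) = ((S.filter fun x => φ (f x) = 1).card : ZMod 2) := by
      rw [map_sum, Finset.card_filter, Nat.cast_sum]
      refine Finset.sum_congr rfl fun x _ => ?_
      generalize φ (f x) = y
      revert y
      decide
    exact key ▸ (hu.map φ).ne_zero
  obtain ⟨x, hx, h⟩ := hH.exists_fixed_mem_of_not_dvd_card (S.filter fun x => φ (f x) = 1)
    (fun h hh x hx => by
      rw [Finset.mem_filter] at hx ⊢
      exact ⟨hS h hh x hx.1, by rw [hf h hh, hx.2]⟩)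
    (fun hd => hφ ((ZMod.natCast_eq_zero_iff _ _).2 hd))
  exact ⟨x, (Finset.mem_filter.1 hx).1, h⟩

open Equiv in
/-- A subgroup of permutations preserving a set of size `m` with complement of size `m`, and fixing
a point on each side, has order dividing `((m - 1)!) ^ 2`. -/
theorem card_dvd_factorial_sq_of_fixed {α : Type*} [Fintype α] [DecidableEq α]
    (H : Subgroup (Perm α)) (I : Finset α) {m : ℕ} (hI : I.card = m) (hI' : Iᶜ.card = m)
    (hH : ∀ h ∈ H, ∀ x, h x ∈ I ↔ x ∈ I) {i j : α} (hi : i ∈ I) (hj : j ∈ Iᶜ)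
    (hfi : ∀ h ∈ H, h i = i) (hfj : ∀ h ∈ H, h j = j) :
    Nat.card H ∣ (m - 1).factorial ^ 2 := by
  have hj' : j ∉ I := Finset.mem_compl.1 hj
  let c : α → Bool × Bool := fun x => (decide (x ∈ I), decide (x = i ∨ x = j))
  have hc : ∀ h ∈ H, c ∘ h = c := by
    intro h hh
    have e1 : ∀ x, h x = i ↔ x = i := fun x => by
      nth_rw 1 [← hfi h hh]
      exact h.injective.eq_iff
    have e2 : ∀ x, h x = j ↔ x = j := fun x => by
      nth_rw 1 [← hfj h hh]
      exact h.injective.eq_iff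
    ext x <;> simp [c, hH h hh, e1, e2]
  have key := card_dvd_prod_factorial_of_comp_eq H c hc
  have c1 : Fintype.card {x // c x = (true, true)} = 1 := by
    rw [Fintype.card_subtype, Finset.card_eq_one]
    exact ⟨i, by ext x; simp [c]; grind⟩
  have c2 : Fintype.card {x // c x = (false, true)} = 1 := by
    rw [Fintype.card_subtype, Finset.card_eq_one]
    exact ⟨j, by ext x; simp [c]; grind⟩
  have c3 : Fintype.card {x // c x = (true, false)} = m - 1 := by
    rw [Fintype.card_subtype, ← hI, ← Finset.card_erase_of_mem hi]
    congr 1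
    ext x
    simp [c]
    grind
  have c4 : Fintype.card {x // c x = (false, false)} = m - 1 := by
    rw [Fintype.card_subtype, ← hI', ← Finset.card_erase_of_mem hj]
    congr 1
    ext x
    simp [c]
    grind
  rw [Fintype.prod_prod_type] at key
  simpa [c1, c2, c3, c4, sq] using key

theorem two_mul_sq_mul_factorial_sq_dvd {m : ℕ} (hm : 0 < m) :
    2 * m ^ 2 * (m - 1).factorial ^ 2 ∣ (2 * m).factorial := by
  have h : (2 * m).factorial = m.centralBinom * m.factorial ^ 2 := by
    rw [Nat.centralBinom_eq_two_mul_choose, two_mul, ← Nat.add_choose_mul_factorial_mul_factorial]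
    ring
  rw [h, ← Nat.mul_factorial_pred hm.ne', mul_pow, ← mul_assoc]
  gcongr
  exact Nat.two_dvd_centralBinom_of_one_le hm

open Equiv in
/-- A 2-subgroup of the permutations of `2 * 2 ^ k` points which preserves a half and fixes a point
on each side has index at least `2 ^ (2 * k + 1)` in a Sylow 2-subgroup. -/
theorem two_pow_mul_card_le_card_sylow {α : Type*} [Fintype α] [DecidableEq α] {k : ℕ}
    (P : Sylow 2 (Perm α)) {H : Subgroup (Perm α)} (hp : IsPGroup 2 H) (I : Finset α)
    (hI : I.card = 2 ^ k) (hI' : Iᶜ.card = 2 ^ k)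
    (hH : ∀ h ∈ H, ∀ x, h x ∈ I ↔ x ∈ I) {i j : α} (hi : i ∈ I) (hj : j ∈ Iᶜ)
    (hfi : ∀ h ∈ H, h i = i) (hfj : ∀ h ∈ H, h j = j) :
    2 ^ (2 * k + 1) * Nat.card H ≤ Nat.card P := by
  obtain ⟨r, hr⟩ := IsPGroup.iff_card.1 hp
  have hd := card_dvd_factorial_sq_of_fixed H I hI hI' hH hi hj hfi hfj
  have hα : Nat.card (Perm α) = (2 * 2 ^ k).factorial := by
    rw [Nat.card_perm, Nat.card_eq_fintype_card, ← Finset.card_add_card_compl I, hI, hI', two_mul]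
  rw [hr] at hd ⊢
  rw [← pow_add]
  refine Nat.le_of_dvd Nat.card_pos (P.pow_dvd_card_of_pow_dvd_card ?_)
  rw [hα]
  refine dvd_trans ?_ (two_mul_sq_mul_factorial_sq_dvd (by positivity : 0 < 2 ^ k))
  rw [pow_add, show 2 ^ (2 * k + 1) = 2 * (2 ^ k) ^ 2 by ring]
  exact mul_dvd_mul_left _ hd

open Equiv in
/-- Orbit-stabilizer for a permutation group acting on functions by permuting coordinates. -/
theorem ncard_orbit_comp_inv_mul_card {α β : Type*} [Finite α] (P : Subgroup (Perm α)) (a : α → β) :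
    ∃ H ≤ P, (∀ h ∈ H, ∀ x, a (h x) = a x) ∧
      {b : α → β | ∃ σ ∈ P, b = a ∘ ⇑σ⁻¹}.ncard * Nat.card H = Nat.card P := by
  let _ : MulAction P (α → β) := arrowAction
  refine ⟨(MulAction.stabilizer P a).map P.subtype, Subgroup.map_subtype_le _, ?_, ?_⟩
  · rintro _ ⟨h, hh, rfl⟩ x
    have key : a (h⁻¹ • h • x) = a (h • x) := congrFun hh (h • x)
    rw [inv_smul_smul] at key
    exact key.symm
  · have horb : {b : α → β | ∃ σ ∈ P, b = a ∘ ⇑σ⁻¹} = MulAction.orbit P a := by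
      ext b
      constructor
      · rintro ⟨σ, hσ, rfl⟩
        exact ⟨⟨σ, hσ⟩, rfl⟩
      · rintro ⟨σ, rfl⟩
        exact ⟨σ, σ.2, rfl⟩
    rw [horb, Subgroup.card_subtype, ← Nat.card_coe_set_eq, ← Nat.card_prod]
    exact Nat.card_congr (MulAction.orbitProdStabilizerEquivGroup P a)

theorem stmt19 (s t : ℕ) (hs : 1 < s) (ht : 1 ≤ t)
    (P : Sylow 2 (Equiv.Perm (Fin (2 ^ t))))
    -- every element of `P` maps the block `I₁ = {i | i < 2^(t-1)}` either into itself
    -- or into its complement `I₂`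
    (hblock : ∀ σ : Equiv.Perm (Fin (2 ^ t)), σ ∈ P →
      (∀ i : Fin (2 ^ t), (i : ℕ) < 2 ^ (t - 1) → ((σ i : ℕ) < 2 ^ (t - 1))) ∨
      (∀ i : Fin (2 ^ t), (i : ℕ) < 2 ^ (t - 1) → 2 ^ (t - 1) ≤ (σ i : ℕ)))
    (a : Fin (2 ^ t) → ZMod (2 ^ s))
    (hsum :
      (∑ i ∈ Finset.univ.filter (fun i : Fin (2 ^ t) => (i : ℕ) < 2 ^ (t - 1)), a i) =
        -(∑ i ∈ Finset.univ.filter (fun i : Fin (2 ^ t) => 2 ^ (t - 1) ≤ (i : ℕ)), a i))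
    (hunit :
      IsUnit (∑ i ∈ Finset.univ.filter (fun i : Fin (2 ^ t) => (i : ℕ) < 2 ^ (t - 1)), a i)) :
    2 ^ (2 * t - 1) ≤
      Set.ncard {b : Fin (2 ^ t) → ZMod (2 ^ s) | ∃ σ ∈ P, b = a ∘ ⇑σ⁻¹} := by
  obtain ⟨k, rfl⟩ : ∃ k, t = k + 1 := ⟨t - 1, by omega⟩
  simp only [Nat.add_sub_cancel] at *
  set I : Finset (Fin (2 ^ (k + 1))) := Finset.univ.filter fun i => (i : ℕ) < 2 ^ k with hIdef
  have hIc : Finset.univ.filter (fun i : Fin (2 ^ (k + 1)) => 2 ^ k ≤ (i : ℕ)) = Iᶜ := by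
    ext x
    simp [I]
  have hmem : ∀ x, x ∈ I ↔ (x : ℕ) < 2 ^ k := by simp [I]
  have hcard : I.card = 2 ^ k := by
    rw [hIdef, Fin.card_filter_val_lt, min_eq_right]
    exact Nat.pow_le_pow_right two_pos k.le_succ
  have hcard' : Iᶜ.card = 2 ^ k := by
    rw [Finset.card_compl, hcard, Fintype.card_fin, pow_succ]
    omega
  rw [hIc] at hsum
  obtain ⟨H, hHP, hHa, hHcard⟩ := ncard_orbit_comp_inv_mul_card (P : Subgroup _) a
  have hp : IsPGroup 2 H := P.isPGroup'.to_le hHP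
  have hmaps : ∀ h ∈ H, ∀ x ∈ I, h x ∈ I := by
    intro h hh
    refine (hblock h (hHP hh)).elim (fun H x => by simpa only [hmem] using H x) fun hswap => ?_
    have himg : I.map h.toEmbedding = Iᶜ := by
      refine Finset.eq_of_subset_of_card_le (fun y hy => ?_) (by simp [hcard, hcard'])
      obtain ⟨x, hx, rfl⟩ := Finset.mem_map.1 hy
      simpa [hmem] using hswap x ((hmem x).1 hx)
    have heq : ∑ x ∈ Iᶜ, a x = ∑ x ∈ I, a x := by
      rw [← himg, Finset.sum_map]
      exact Finset.sum_congr rfl fun x _ => hHa h hh x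
    have h2 : (2 : ZMod (2 ^ s)) * ∑ x ∈ I, a x = 0 := by
      rw [heq] at hsum
      rw [two_mul]
      nth_rw 1 [hsum]
      exact neg_add_cancel _
    rw [hunit.mul_left_eq_zero] at h2
    have hdvd : 2 ^ s ∣ 2 := (ZMod.natCast_eq_zero_iff 2 (2 ^ s)).1 (by exact_mod_cast h2)
    have : 2 ^ 2 ≤ 2 ^ s := Nat.pow_le_pow_right two_pos hs
    have := Nat.le_of_dvd two_pos hdvd
    omega
  have hiff : ∀ h ∈ H, ∀ x, h x ∈ I ↔ x ∈ I := fun h hh x =>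
    ⟨fun hx => by simpa using hmaps h⁻¹ (inv_mem hh) _ hx, hmaps h hh x⟩
  obtain ⟨i, hi, hfi⟩ := exists_fixed_mem_of_isUnit_sum (by omega) hp I hmaps a hHa hunit
  obtain ⟨j, hj, hfj⟩ := exists_fixed_mem_of_isUnit_sum (by omega) hp Iᶜ
    (fun h hh x hx => by simpa [hiff h hh] using hx) a hHa
    (by rw [hsum] at hunit; simpa using hunit.neg)
  have hle := two_pow_mul_card_le_card_sylow P hp I hcard hcard' hiff hi hj hfi hfj
  exact Nat.le_of_mul_le_mul_right (hle.trans_eq hHcard.symm) Nat.card_pos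
end
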